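/- arXiv:2402.07526 — 10 statements merged into one kernel-verified Lean document; each statement's English description precedes it below -/
import Mathlib

section
/- Let K be a simplicial complex and let W be a Morse sequence on K. Then the gradient vector field of W (the set of all regular pairs of W) is a discrete vector field on K that is acyclic, i.e., it contains no non-trivial closed p-gradient path for any p. -/
/- Basic notions: simplicial complexes, facets, free pairs, expansions,
   fillings, collapses, Morse sequences, discrete vector fields,
   gradient paths, Morse functions. -/

variable {α : Type*} [DecidableEq α]

/-- A (simplicial) complex: a finite family of nonempty finite sets that is
closed under taking nonempty subsets. -/
def IsComplex (K : Finset (Finset α)) : Prop :=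
  ∅ ∉ K ∧ ∀ τ ∈ K, ∀ σ : Finset α, σ.Nonempty → σ ⊆ τ → σ ∈ K

/-- A facet of `K`: a face maximal for inclusion. -/
def Facet (K : Finset (Finset α)) (σ : Finset α) : Prop :=
  σ ∈ K ∧ ∀ τ ∈ K, σ ⊆ τ → τ = σ

/-- `(σ, τ)` is a free pair for `K`: `τ` is the only face of `K`
properly containing `σ`. -/
def FreePair (K : Finset (Finset α)) (σ τ : Finset α) : Prop :=
  σ ∈ K ∧ τ ∈ K ∧ σ ⊂ τ ∧ ∀ ν ∈ K, σ ⊂ ν → ν = τ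

/-- `K` is an elementary expansion of `L` (equivalently, `L` is an
elementary collapse of `K`). -/
def ElemExpansion (L K : Finset (Finset α)) : Prop :=
  ∃ σ τ : Finset α, FreePair K σ τ ∧ L = K \ {σ, τ}

/-- `K` is an elementary filling of `L` (equivalently, `L` is an
elementary perforation of `K`). -/
def ElemFilling (L K : Finset (Finset α)) : Prop :=
  ∃ σ : Finset α, Facet K σ ∧ L = K.erase σ

/-- `L` is an elementary collapse of `K`. -/
def ElemCollapse (K L : Finset (Finset α)) : Prop := ElemExpansion L K

/-- `K` collapses onto `L`: a finite sequence of elementary collapses from `K` to `L`. -/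
def CollapsesOnto (K L : Finset (Finset α)) : Prop :=
  Relation.ReflTransGen (fun A B : Finset (Finset α) => ElemCollapse A B) K L

/-- `K` is collapsible: `K` collapses onto a single vertex. -/
def Collapsible (K : Finset (Finset α)) : Prop :=
  ∃ a : α, CollapsesOnto K {({a} : Finset α)}

/-- A Morse sequence on `K`: a sequence `∅ = K_0, …, K_k = K` of simplicial
complexes where each step is an elementary expansion or an elementary filling. -/
structure MorseSequence (K : Finset (Finset α)) where
  k : ℕ
  seq : ℕ → Finset (Finset α)
  cplx : ∀ i ≤ k, IsComplex (seq i)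
  first : seq 0 = ∅
  last : seq k = K
  step : ∀ i < k, ElemExpansion (seq i) (seq (i + 1)) ∨ ElemFilling (seq i) (seq (i + 1))

/-- `σ` is a critical face of the Morse sequence `W`: it is the simplex added
by some elementary filling step of `W`. -/
def CriticalFace {K : Finset (Finset α)} (W : MorseSequence K) (σ : Finset α) : Prop :=
  ∃ i < W.k, σ ∈ W.seq (i + 1) ∧ W.seq i = (W.seq (i + 1)).erase σ

/-- `(σ, τ)` is a regular pair of the Morse sequence `W`: it is the free pair
added by some elementary expansion step of `W`. -/
def RegularPair {K : Finset (Finset α)} (W : MorseSequence K) (σ τ : Finset α) : Prop :=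
  ∃ i < W.k, FreePair (W.seq (i + 1)) σ τ ∧ W.seq i = W.seq (i + 1) \ {σ, τ}

/-- The gradient vector field of a Morse sequence: the set of its regular pairs. -/
def gradVF {K : Finset (Finset α)} (W : MorseSequence K) : Set (Finset α × Finset α) :=
  {p | RegularPair W p.1 p.2}

/-- `σ ∈ ∂τ`: `σ` is a codimension-one face of `τ`. -/
def InBoundary (σ τ : Finset α) : Prop := σ ⊆ τ ∧ σ.card + 1 = τ.card

/-- Each simplex belongs to at most one pair of `V`. -/
def PairwiseDisjointPairs (V : Set (Finset α × Finset α)) : Prop :=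
  ∀ p ∈ V, ∀ q ∈ V, (p.1 = q.1 ∨ p.1 = q.2 ∨ p.2 = q.1 ∨ p.2 = q.2) → p = q

/-- A discrete vector field on `K`. -/
def IsDVF (K : Finset (Finset α)) (V : Set (Finset α × Finset α)) : Prop :=
  (∀ p ∈ V, p.1 ∈ K ∧ p.2 ∈ K ∧ InBoundary p.1 p.2) ∧ PairwiseDisjointPairs V

/-- `ν` is critical for the discrete vector field `V`: it belongs to no pair of `V`. -/
def CriticalForVF (V : Set (Finset α × Finset α)) (ν : Finset α) : Prop :=
  ∀ p ∈ V, ν ≠ p.1 ∧ ν ≠ p.2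

/-- A `p`-gradient path `⟨σ_0, τ_0, …, σ_{k-1}, τ_{k-1}, σ_k⟩` in `V`. -/
def IsGradPath (K : Finset (Finset α)) (V : Set (Finset α × Finset α))
    (p k : ℕ) (σ τ : ℕ → Finset α) : Prop :=
  (∀ i ≤ k, σ i ∈ K ∧ (σ i).card = p + 1) ∧
  (∀ i < k, τ i ∈ K ∧ (τ i).card = p + 2) ∧
  (∀ i < k, (σ i, τ i) ∈ V ∧ σ (i + 1) ⊂ τ i ∧ σ (i + 1) ≠ σ i)

/-- `V` is acyclic: no non-trivial closed `p`-gradient path. -/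
def AcyclicVF (K : Finset (Finset α)) (V : Set (Finset α × Finset α)) : Prop :=
  ∀ (p k : ℕ) (σ τ : ℕ → Finset α), IsGradPath K V p k σ τ → 1 ≤ k → σ 0 ≠ σ k

/-- `(η, ν)` is an extension of the `p`-gradient path `(σ, τ)` of length `k` in `V`:
prepending `⟨η, ν⟩` or appending `⟨ν, η⟩` yields a `p`-gradient path in `V`. -/
def IsExtension (K : Finset (Finset α)) (V : Set (Finset α × Finset α))
    (p k : ℕ) (σ τ : ℕ → Finset α) (η ν : Finset α) : Prop :=
  IsGradPath K V p (k + 1)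
    (fun i => if i = 0 then η else σ (i - 1)) (fun i => if i = 0 then ν else τ (i - 1)) ∨
  IsGradPath K V p (k + 1)
    (fun i => if i ≤ k then σ i else η) (fun i => if i < k then τ i else ν)

/-- A maximal `p`-gradient path in `V`: one that admits no extension. -/
def MaximalPath (K : Finset (Finset α)) (V : Set (Finset α × Finset α))
    (p k : ℕ) (σ τ : ℕ → Finset α) : Prop :=
  IsGradPath K V p k σ τ ∧ ∀ η ν : Finset α, ¬ IsExtension K V p k σ τ η ν

/-- `V(f)`: the pairs `(σ, τ)` of faces of `K` with `σ ∈ ∂τ` and `f σ ≥ f τ`. -/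
def Vf (K : Finset (Finset α)) (f : Finset α → ℤ) : Set (Finset α × Finset α) :=
  {p | p.1 ∈ K ∧ p.2 ∈ K ∧ InBoundary p.1 p.2 ∧ f p.2 ≤ f p.1}

/-- `f` is a (discrete) Morse function on `K`: each simplex of `K` is in at most
one pair of `V(f)`; `V(f)` is then the gradient vector field of `f`. -/
def IsMorseFunction (K : Finset (Finset α)) (f : Finset α → ℤ) : Prop :=
  PairwiseDisjointPairs (Vf K f)

/-- `f` is a Morse function on the Morse sequence `W`. -/
def IsMorseFunctionOnSeq {K : Finset (Finset α)} (W : MorseSequence K)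
    (f : Finset α → ℤ) : Prop :=
  (∀ σc, CriticalFace W σc → ∀ σ ∈ K, InBoundary σ σc → f σ < f σc) ∧
  (∀ σ τ : Finset α, RegularPair W σ τ → f τ ≤ f σ)

/-- The canonical Morse function of a Morse sequence `W`: each simplex is sent to
the index of the step of `W` at which it is added. -/
noncomputable def canonicalMF {K : Finset (Finset α)} (W : MorseSequence K)
    (σ : Finset α) : ℤ :=
  ((sInf {i : ℕ | σ ∈ W.seq i} : ℕ) : ℤ)

/-- A basic Morse function on `K`: monotone, semi-injective and generic. -/
def IsBasicMorseFunction (K : Finset (Finset α)) (f : Finset α → ℤ) : Prop :=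
  (∀ σ ∈ K, ∀ τ ∈ K, σ ⊆ τ → f σ ≤ f τ) ∧
  (∀ i : ℤ, (K.filter fun σ => f σ = i).card ≤ 2) ∧
  (∀ σ ∈ K, ∀ τ ∈ K, f σ = f τ → σ ⊆ τ ∨ τ ⊆ σ)

/-- Two functions are strongly equivalent on `K` if they induce the same order on `K`. -/
def StronglyEquiv (K : Finset (Finset α)) (f g : Finset α → ℤ) : Prop :=
  ∀ σ ∈ K, ∀ τ ∈ K, (f σ ≤ f τ ↔ g σ ≤ g τ)

/-- `L` is maximal for `K`: no elementary expansion of `L` is a subset of `K`. -/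
def MaximalIn (K L : Finset (Finset α)) : Prop :=
  ¬ ∃ M : Finset (Finset α), ElemExpansion L M ∧ M ⊆ K

/-- A Morse sequence is maximal if a filling is performed only when no expansion
(within `K`) is possible. -/
def MaximalMorseSeq {K : Finset (Finset α)} (W : MorseSequence K) : Prop :=
  ∀ i < W.k, ElemFilling (W.seq i) (W.seq (i + 1)) → MaximalIn K (W.seq i)

/-- The number of connected components of a graph `K`: vertices `a`, `b` are
identified when `{a, b}` is an edge of `K` (hence, when they are joined by a
path of edges of `K`). -/
noncomputable def numComponents (K : Finset (Finset α)) : ℕ :=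
  Nat.card (Quot (fun a b : {x : α // ({x} : Finset α) ∈ K} =>
    ({a.1, b.1} : Finset α) ∈ K))

theorem FreePair.inBoundary {K : Finset (Finset α)} (hK : IsComplex K) {σ τ : Finset α}
    (h : FreePair K σ τ) : InBoundary σ τ := by
  obtain ⟨-, hτ, hστ, huniq⟩ := h
  obtain ⟨x, hxτ, hxσ⟩ := Finset.exists_of_ssubset hστ
  have hins : insert x σ = τ :=
    huniq _ (hK.2 τ hτ _ (Finset.insert_nonempty x σ)
      (Finset.insert_subset hxτ hστ.subset)) (Finset.ssubset_insert hxσ)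
  exact ⟨hστ.subset, by rw [← hins, Finset.card_insert_of_notMem hxσ]⟩

namespace MorseSequence

variable {K : Finset (Finset α)} (W : MorseSequence K)

theorem seq_subset_seq {i j : ℕ} (hij : i ≤ j) (hj : j ≤ W.k) : W.seq i ⊆ W.seq j := by
  induction j, hij using Nat.le_induction with
  | base => exact subset_rfl
  | succ j _ ih =>
    refine (ih (by omega)).trans ?_
    rcases W.step j (by omega) with ⟨σ, τ, -, h⟩ | ⟨σ, -, h⟩
    · exact h ▸ Finset.sdiff_subset
    · exact h ▸ Finset.erase_subset _ _

theorem seq_subset {i : ℕ} (hi : i ≤ W.k) : W.seq i ⊆ K := by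
  simpa only [W.last] using W.seq_subset_seq hi le_rfl

/-- The step at which a face appears is unique. -/
theorem step_unique {i j : ℕ} (hi : i < W.k) (hj : j < W.k) {ν : Finset α}
    (hi₁ : ν ∈ W.seq (i + 1)) (hi₀ : ν ∉ W.seq i)
    (hj₁ : ν ∈ W.seq (j + 1)) (hj₀ : ν ∉ W.seq j) : i = j := by
  rcases lt_trichotomy i j with h | h | h
  · exact absurd (W.seq_subset_seq h hj.le hi₁) hj₀
  · exact h
  · exact absurd (W.seq_subset_seq h hi.le hj₁) hi₀

theorem pairwiseDisjointPairs_gradVF : PairwiseDisjointPairs (gradVF W) := by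
  rintro ⟨σ, τ⟩ ⟨i, hi, ⟨hσ, hτ, hστ, -⟩, hie⟩ ⟨σ', τ'⟩ ⟨j, hj, ⟨hσ', hτ', hστ', -⟩, hje⟩ h
  dsimp only at *
  have hσ₀ : σ ∉ W.seq i := by simp [hie]
  have hτ₀ : τ ∉ W.seq i := by simp [hie]
  have hσ'₀ : σ' ∉ W.seq j := by simp [hje]
  have hτ'₀ : τ' ∉ W.seq j := by simp [hje]
  have hij : i = j := by
    rcases h with rfl | rfl | rfl | rfl
    · exact W.step_unique hi hj hσ hσ₀ hσ' hσ'₀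
    · exact W.step_unique hi hj hσ hσ₀ hτ' hτ'₀
    · exact W.step_unique hi hj hτ hτ₀ hσ' hσ'₀
    · exact W.step_unique hi hj hτ hτ₀ hτ' hτ'₀
  subst hij
  have hmem : ∀ ν ∈ W.seq (i + 1), ν ∉ W.seq i → ν = σ' ∨ ν = τ' := by
    intro ν h₁ h₀
    rw [hje] at h₀
    simpa [h₁, or_iff_not_imp_left] using h₀
  rcases hmem σ hσ hσ₀ with rfl | rfl <;> rcases hmem τ hτ hτ₀ with rfl | rfl
  · exact absurd hστ (ssubset_irrefl _)
  · rfl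
  · exact absurd (hστ.trans hστ') (ssubset_irrefl _)
  · exact absurd hστ (ssubset_irrefl _)

theorem isDVF_gradVF : IsDVF K (gradVF W) := by
  refine ⟨?_, W.pairwiseDisjointPairs_gradVF⟩
  rintro ⟨σ, τ⟩ ⟨i, hi, h, -⟩
  exact ⟨W.seq_subset hi h.1, W.seq_subset hi h.2.1, h.inBoundary (W.cplx _ hi)⟩

theorem acyclicVF_gradVF : AcyclicVF K (gradVF W) := by
  rintro p k σ τ ⟨hσ, -, hV⟩ hk hclosed
  have hstep : ∀ i < k, ∃ n < W.k, σ i ∉ W.seq n ∧ σ (i + 1) ∈ W.seq n := by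
    intro i hi
    obtain ⟨⟨n, hn, hfree, hne⟩, hss, hneq⟩ := hV i hi
    dsimp only at hfree hne
    refine ⟨n, hn, by simp [hne], ?_⟩
    have hnonempty : (σ (i + 1)).Nonempty := by
      rw [← Finset.card_pos, (hσ (i + 1) hi).2]
      omega
    have hmem := (W.cplx _ hn).2 _ hfree.2.1 _ hnonempty hss.subset
    rw [hne]
    simp [hmem, hneq, hss.ne]
  obtain ⟨n, hn, hσ₀, hσ₁⟩ := hstep 0 hk
  have hall : ∀ j, 1 ≤ j → j ≤ k → σ j ∈ W.seq n := by
    intro j hj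
    induction j, hj using Nat.le_induction with
    | base => exact fun _ => hσ₁
    | succ j _ ih =>
      intro hjk
      obtain ⟨m, hm, hm₀, hm₁⟩ := hstep j hjk
      have hmn : m ≤ n := by
        by_contra! hlt
        exact hm₀ (W.seq_subset_seq hlt.le hm.le (ih (by omega)))
      exact W.seq_subset_seq hmn hn.le hm₁
  exact hσ₀ (hclosed ▸ hall k hk le_rfl)

end MorseSequence

/-- The gradient vector field of a Morse sequence on `K` is an
acyclic discrete vector field on `K`. -/
theorem gradVF_isDVF_and_acyclic {α : Type*} [DecidableEq α]
    (K : Finset (Finset α)) (W : MorseSequence K) :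
    IsDVF K (gradVF W) ∧ AcyclicVF K (gradVF W) :=
  ⟨W.isDVF_gradVF, W.acyclicVF_gradVF⟩
end

section
/- Let K be a simplicial complex and let V be an acyclic discrete vector field on K. Then there exists a Morse sequence W on K whose gradient vector field is exactly V. -/
/- Basic notions: simplicial complexes, facets, free pairs, expansions,
   fillings, collapses, Morse sequences, discrete vector fields,
   gradient paths, Morse functions. -/

variable {α : Type*} [DecidableEq α]

/-- A Morse sequence can be prolonged by one elementary step; its regular pairs are the old ones
together with those added by the last step. -/
theorem MorseSequence.exists_snoc {α : Type*} [DecidableEq α] {L K : Finset (Finset α)}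
    (W : MorseSequence L) (hK : IsComplex K) (h : ElemExpansion L K ∨ ElemFilling L K) :
    ∃ W' : MorseSequence K, ∀ σ τ : Finset α, RegularPair W' σ τ ↔
      RegularPair W σ τ ∨ (FreePair K σ τ ∧ L = K \ {σ, τ}) := by
  have hlast : W.seq W.k = L := W.last
  refine ⟨{ k := W.k + 1
            seq := fun i => if i ≤ W.k then W.seq i else K
            cplx := ?_
            first := by simpa using W.first
            last := by simp
            step := ?_ }, ?_⟩
  · intro i _
    by_cases hi : i ≤ W.k
    · simpa [hi] using W.cplx i hi
    · simpa [hi] using hK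
  · intro i hi
    rcases Nat.lt_succ_iff_lt_or_eq.mp hi with hi | rfl
    · simpa [hi.le, Nat.succ_le_of_lt hi] using W.step i hi
    · simpa [hlast] using h
  · intro σ τ
    constructor
    · rintro ⟨i, hi, hfree, heq⟩
      rcases Nat.lt_succ_iff_lt_or_eq.mp hi with hi | rfl
      · exact Or.inl ⟨i, hi, by simpa [Nat.succ_le_of_lt hi] using hfree,
          by simpa [hi.le, Nat.succ_le_of_lt hi] using heq⟩
      · exact Or.inr ⟨by simpa using hfree, by simpa [hlast] using heq⟩
    · rintro (⟨i, hi, hfree, heq⟩ | ⟨hfree, heq⟩)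
      · exact ⟨i, Nat.lt_succ_of_lt hi, by simpa [Nat.succ_le_of_lt hi] using hfree,
          by simpa [hi.le, Nat.succ_le_of_lt hi] using heq⟩
      · exact ⟨W.k, Nat.lt_succ_self _, by simpa using hfree, by simpa [hlast] using heq⟩

theorem IsComplex.erase_facet {α : Type*} [DecidableEq α] {K : Finset (Finset α)} {ρ : Finset α}
    (hK : IsComplex K) (hρ : Facet K ρ) : IsComplex (K.erase ρ) := by
  refine ⟨fun h => hK.1 (Finset.mem_of_mem_erase h), fun τ hτ σ hσ hστ => ?_⟩
  rw [Finset.mem_erase] at hτ ⊢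
  refine ⟨?_, hK.2 τ hτ.2 σ hσ hστ⟩
  rintro rfl
  exact hτ.1 (hρ.2 τ hτ.2 hστ)

theorem IsComplex.sdiff_freePair {α : Type*} [DecidableEq α] {K : Finset (Finset α)}
    {σ τ : Finset α} (hK : IsComplex K) (h : FreePair K σ τ) : IsComplex (K \ {σ, τ}) := by
  obtain ⟨-, -, hlt, huniq⟩ := h
  refine ⟨fun h => hK.1 (Finset.mem_sdiff.mp h).1, fun ν hν μ hμ hμν => ?_⟩
  simp only [Finset.mem_sdiff, Finset.mem_insert, Finset.mem_singleton, not_or] at hν ⊢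
  refine ⟨hK.2 ν hν.1 μ hμ hμν, ?_, ?_⟩
  · rintro rfl
    exact hν.2.2 (huniq ν hν.1 (hμν.ssubset_of_ne (Ne.symm hν.2.1)))
  · rintro rfl
    exact hν.2.2 (huniq ν hν.1 (hlt.trans_subset hμν))

theorem FreePair.eq_of_sdiff_eq {α : Type*} [DecidableEq α] {K : Finset (Finset α)}
    {σ τ σ' τ' : Finset α} (h : FreePair K σ τ) (h' : FreePair K σ' τ')
    (heq : K \ {σ, τ} = K \ {σ', τ'}) : σ' = σ ∧ τ' = τ := by
  have key : ∀ ν ∈ K, (ν = σ ∨ ν = τ) ↔ (ν = σ' ∨ ν = τ') := by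
    intro ν hν
    have := Finset.ext_iff.mp heq ν
    simp only [Finset.mem_sdiff, hν, true_and, Finset.mem_insert, Finset.mem_singleton] at this
    exact not_iff_not.mp this
  rcases (key σ' h'.1).mpr (Or.inl rfl) with e | e
  · refine ⟨e, ?_⟩
    rcases (key τ' h'.2.1).mpr (Or.inr rfl) with e' | e'
    · exact absurd (e.trans e'.symm) h'.2.2.1.ne
    · exact e'
  · rcases (key τ' h'.2.1).mpr (Or.inr rfl) with e' | e'
    · have h1 := h'.2.2.1
      rw [e, e'] at h1
      exact absurd (h1.trans h.2.2.1) (ssubset_irrefl _)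
    · exact absurd (e.trans e'.symm) h'.2.2.1.ne

theorem FreePair.erase_ne_sdiff {α : Type*} [DecidableEq α] {K : Finset (Finset α)}
    {σ τ ρ : Finset α} (h : FreePair K σ τ) : K.erase ρ ≠ K \ {σ, τ} := by
  intro heq
  have key : ∀ ν ∈ K, ν = σ ∨ ν = τ → ν = ρ := by
    intro ν hν hor
    by_contra hne
    have hmem : ν ∈ K \ {σ, τ} := heq ▸ Finset.mem_erase.mpr ⟨hne, hν⟩
    simp [hor] at hmem
  exact h.2.2.1.ne ((key σ h.1 (Or.inl rfl)).trans (key τ h.2.1 (Or.inr rfl)).symm)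

theorem AcyclicVF.mono {α : Type*} {K L : Finset (Finset α)}
    {V U : Set (Finset α × Finset α)} (hac : AcyclicVF K V) (hL : L ⊆ K) (hU : U ⊆ V) :
    AcyclicVF L U := fun p k σ τ hp =>
  hac p k σ τ ⟨fun i hi => ⟨hL (hp.1 i hi).1, (hp.1 i hi).2⟩,
    fun i hi => ⟨hL (hp.2.1 i hi).1, (hp.2.1 i hi).2⟩,
    fun i hi => ⟨hU (hp.2.2 i hi).1, (hp.2.2 i hi).2⟩⟩

/-- An acyclic discrete vector field on a nonempty complex leaves some facet critical or contains
a free pair. -/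
theorem AcyclicVF.exists_critical_facet_or_freePair {α : Type*} [DecidableEq α]
    {K : Finset (Finset α)} (hK : IsComplex K) (hne : K.Nonempty)
    {V : Set (Finset α × Finset α)} (hV : IsDVF K V) (hac : AcyclicVF K V) :
    (∃ ρ, Facet K ρ ∧ CriticalForVF V ρ) ∨ ∃ p ∈ V, FreePair K p.1 p.2 := by
  obtain ⟨μ, hμ, hmax⟩ := K.exists_max_image Finset.card hne
  by_contra! hcon
  obtain ⟨hfacet, hfree⟩ := hcon
  -- every top-dimensional face is the upper face of a pair
  have htop : ∀ ν ∈ K, ν.card = μ.card → ∃ p ∈ V, p.2 = ν := by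
    intro ν hν hcard
    have hf : Facet K ν := ⟨hν, fun τ hτ hντ =>
      (Finset.eq_of_subset_of_card_le hντ (hcard ▸ hmax τ hτ)).symm⟩
    have hnc := hfacet ν hf
    simp only [CriticalForVF, not_forall] at hnc
    obtain ⟨p, hp, hor⟩ := hnc
    refine ⟨p, hp, ?_⟩
    by_contra hne2
    refine hor ⟨fun h1 => ?_, fun h2 => hne2 h2.symm⟩
    have h3 := (hV.1 p hp).2.2.2
    have h4 := hmax p.2 (hV.1 p hp).2.1
    rw [← h1] at h3
    omega
  let T := {p : Finset α × Finset α // p ∈ V ∧ p.2.card = μ.card}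
  have hnext : ∀ p : T, ∃ q : T, p.1.1 ⊂ q.1.2 ∧ p.1.1 ≠ q.1.1 := by
    rintro ⟨p, hp, hcard⟩
    obtain ⟨h1, h2, hsub, hc⟩ := hV.1 p hp
    have hlt : p.1 ⊂ p.2 := hsub.ssubset_of_ne fun h => by rw [h] at hc; omega
    have hnf := hfree p hp
    simp only [FreePair, h1, h2, hlt, true_and, not_forall] at hnf
    obtain ⟨ν, hν, hpν, hνne⟩ := hnf
    have hνcard : ν.card = μ.card := by
      have := Finset.card_lt_card hpν
      have := hmax ν hν
      omega
    obtain ⟨q, hq, rfl⟩ := htop ν hν hνcard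
    refine ⟨⟨q, hq, hνcard⟩, hpν, fun h => hνne ?_⟩
    rw [hV.2 p hp q hq (Or.inl h)]
  choose next hnext using hnext
  obtain ⟨p₀, hp₀, hp₀μ⟩ := htop μ hμ rfl
  let start : T := ⟨p₀, hp₀, by rw [hp₀μ]⟩
  let s : ℕ → T := fun n => next^[n] start
  have hs : ∀ n, s (n + 1) = next (s n) := fun n => Function.iterate_succ_apply' _ _ _
  have hfin : Finite T := by
    have : Finite (K ×ˢ K : Finset (Finset α × Finset α)) := inferInstance
    exact Finite.of_injective
      (fun p : T => (⟨p.1, Finset.mem_product.mpr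
        ⟨(hV.1 p.1 p.2.1).1, (hV.1 p.1 p.2.1).2.1⟩⟩ :
          (K ×ˢ K : Finset (Finset α × Finset α))))
      fun p q h => Subtype.ext (congrArg (fun x => x.1) h)
  obtain ⟨m, n, hmn, hsmn⟩ : ∃ m n, m < n ∧ s m = s n := by
    obtain ⟨a, b, hab, h⟩ := Finite.exists_ne_map_eq_of_infinite s
    rcases lt_or_gt_of_ne hab with h' | h'
    · exact ⟨a, b, h', h⟩
    · exact ⟨b, a, h', h.symm⟩
  have hcard : ∀ p : T, p.1.1.card = (μ.card - 2) + 1 ∧ p.1.2.card = (μ.card - 2) + 2 := by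
    rintro ⟨p, hp, hcard⟩
    obtain ⟨h1, -, -, hc⟩ := hV.1 p hp
    have hpos : 0 < p.1.card := Finset.card_pos.mpr
      (Finset.nonempty_iff_ne_empty.mpr fun h => hK.1 (h ▸ h1))
    dsimp only
    omega
  refine hac (μ.card - 2) (n - m) (fun i => (s (n - i)).1.1) (fun i => (s (n - i)).1.2)
    ⟨fun i _ => ⟨(hV.1 _ (s (n - i)).2.1).1, (hcard _).1⟩,
      fun i _ => ⟨(hV.1 _ (s (n - i)).2.1).2.1, (hcard _).2⟩,
      fun i hi => ⟨(s (n - i)).2.1, ?_⟩⟩ (by omega) ?_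
  · have h := hnext (s (n - (i + 1)))
    rwa [← hs, show n - (i + 1) + 1 = n - i by omega] at h
  · rw [Nat.sub_zero, Nat.sub_sub_self hmn.le, hsmn]

/-- Every acyclic discrete vector field on a simplicial complex `K`
is the gradient vector field of some Morse sequence on `K`. -/
theorem acyclic_eq_gradVF_of_morseSequence {α : Type*} [DecidableEq α]
    (K : Finset (Finset α)) (hK : IsComplex K)
    (V : Set (Finset α × Finset α)) (hV : IsDVF K V) (hac : AcyclicVF K V) :
    ∃ W : MorseSequence K, gradVF W = V := by
  induction K using Finset.strongInduction generalizing V with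
  | H K ih =>
    rcases K.eq_empty_or_nonempty with rfl | hne
    · refine ⟨⟨0, fun _ => ∅, fun _ _ => hK, rfl, rfl, fun i hi => absurd hi i.not_lt_zero⟩, ?_⟩
      ext p
      constructor
      · rintro ⟨i, hi, -⟩
        exact absurd hi i.not_lt_zero
      · intro hp
        exact absurd (hV.1 p hp).1 (Finset.notMem_empty _)
    rcases hac.exists_critical_facet_or_freePair hK hne hV with ⟨ρ, hρ, hcrit⟩ | ⟨p, hp, hfree⟩
    · obtain ⟨W, hW⟩ := ih (K.erase ρ) (Finset.erase_ssubset hρ.1) (hK.erase_facet hρ) V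
        ⟨fun q hq => ⟨Finset.mem_erase.mpr ⟨(hcrit q hq).1.symm, (hV.1 q hq).1⟩,
          Finset.mem_erase.mpr ⟨(hcrit q hq).2.symm, (hV.1 q hq).2.1⟩, (hV.1 q hq).2.2⟩, hV.2⟩
        (hac.mono (Finset.erase_subset _ _) subset_rfl)
      obtain ⟨W', hW'⟩ := W.exists_snoc hK (Or.inr ⟨ρ, hρ, rfl⟩)
      refine ⟨W', ?_⟩
      rw [← hW]
      ext q
      exact (hW' q.1 q.2).trans (or_iff_left fun h => h.1.erase_ne_sdiff h.2)
    · have hlt : K \ {p.1, p.2} ⊂ K := Finset.sdiff_ssubset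
        (Finset.insert_subset hfree.1 (Finset.singleton_subset_iff.mpr hfree.2.1)) (by simp)
      have hmem : ∀ q ∈ V \ {p}, q.1 ∈ K \ {p.1, p.2} ∧ q.2 ∈ K \ {p.1, p.2} := by
        rintro q ⟨hq, hqp⟩
        have h := fun h => hqp (hV.2 q hq p hp h)
        simp only [Finset.mem_sdiff, Finset.mem_insert, Finset.mem_singleton]
        exact ⟨⟨(hV.1 q hq).1, by tauto⟩, (hV.1 q hq).2.1, by tauto⟩
      obtain ⟨W, hW⟩ := ih _ hlt (hK.sdiff_freePair hfree) (V \ {p})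
        ⟨fun q hq => ⟨(hmem q hq).1, (hmem q hq).2, (hV.1 q hq.1).2.2⟩,
          fun q hq r hr => hV.2 q hq.1 r hr.1⟩
        (hac.mono hlt.subset Set.sdiff_subset)
      obtain ⟨W', hW'⟩ := W.exists_snoc hK (Or.inl ⟨p.1, p.2, hfree, rfl⟩)
      refine ⟨W', ?_⟩
      ext q
      refine (hW' q.1 q.2).trans ?_
      have hWq : RegularPair W q.1 q.2 ↔ q ∈ V \ {p} := by rw [← hW]; rfl
      rw [hWq]
      constructor
      · rintro (h | ⟨h, heq⟩)
        · exact h.1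
        · obtain ⟨h1, h2⟩ := hfree.eq_of_sdiff_eq h heq
          rwa [show q = p from Prod.ext h1 h2]
      · intro hq
        by_cases hqp : q = p
        · exact Or.inr (hqp.symm ▸ ⟨hfree, rfl⟩)
        · exact Or.inl ⟨hq, hqp⟩
end

section
/- (Deconstruction lemma) Let K be a nonempty simplicial complex of dimension d and let V be an acyclic discrete vector field on K. Then at least one of the following holds: (1) there exists a facet τ of K with dim(τ) = d that is critical for V; or (2) there exists a pair (σ,τ) ∈ V with dim(τ) = d that is a free pair for K. -/
/- Basic notions: simplicial complexes, facets, free pairs, expansions,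
   fillings, collapses, Morse sequences, discrete vector fields,
   gradient paths, Morse functions. -/

variable {α : Type*} [DecidableEq α]

/-- An infinite sequence of pairs of `V` of top cardinality `p + 2`, each followed by a pair whose
second member properly contains its first one, yields a closed gradient path. -/
theorem AcyclicVF.not_backward_sequence {β : Type*} {K : Finset (Finset β)}
    {V : Set (Finset β × Finset β)} (hV : IsDVF K V) (hac : AcyclicVF K V) (p : ℕ)
    (s : ℕ → Finset β × Finset β) (hs : ∀ n, s n ∈ V ∧ (s n).2.card = p + 2)
    (hstep : ∀ n, (s n).1 ⊂ (s (n + 1)).2 ∧ (s n).1 ≠ (s (n + 1)).1) : False := by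
  have hcard : ∀ n, (s n).1.card = p + 1 := fun n => by
    have h₁ := (hV.1 _ (hs n).1).2.2.2
    have h₂ := (hs n).2
    omega
  have hrep : ∃ i j, i < j ∧ (s i).1 = (s j).1 := by
    obtain ⟨i, j, hij, h⟩ := Finite.exists_ne_map_eq_of_infinite
      (fun n => (⟨(s n).1, (hV.1 _ (hs n).1).1⟩ : K))
    have h' : (s i).1 = (s j).1 := congrArg Subtype.val h
    rcases lt_or_gt_of_ne hij with hlt | hlt
    · exact ⟨i, j, hlt, h'⟩
    · exact ⟨j, i, hlt, h'.symm⟩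
  obtain ⟨i, j, hij, h⟩ := hrep
  refine hac p (j - i) (fun n => (s (j - n)).1) (fun n => (s (j - n)).2)
    ⟨fun n _ => ⟨(hV.1 _ (hs _).1).1, hcard _⟩,
      fun n _ => ⟨(hV.1 _ (hs _).1).2.1, (hs _).2⟩, fun n hn => ?_⟩ (by omega) ?_
  · have hsucc : j - n = j - (n + 1) + 1 := by omega
    refine ⟨(hs _).1, ?_⟩
    simpa only [hsucc] using hstep (j - (n + 1))
  · have hlast : j - (j - i) = i := by omega
    simpa only [Nat.sub_zero, hlast] using h.symm

/-- deconstruction lemma: if `K` is a nonempty complex of dimension `d`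
and `V` is an acyclic discrete vector field on `K`, then either some `d`-dimensional
facet of `K` is critical for `V`, or some pair `(σ, τ) ∈ V` with `dim τ = d` is a
free pair for `K`. -/
theorem deconstruction {α : Type*} [DecidableEq α]
    (K : Finset (Finset α)) (hK : IsComplex K) (hne : K.Nonempty)
    (d : ℕ) (hbd : ∀ σ ∈ K, σ.card ≤ d + 1) (htop : ∃ σ ∈ K, σ.card = d + 1)
    (V : Set (Finset α × Finset α)) (hV : IsDVF K V) (hac : AcyclicVF K V) :
    (∃ τ : Finset α, Facet K τ ∧ τ.card = d + 1 ∧ CriticalForVF V τ) ∨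
    (∃ σ τ : Finset α, (σ, τ) ∈ V ∧ τ.card = d + 1 ∧ FreePair K σ τ) := by
  by_contra hcon
  push Not at hcon
  obtain ⟨hcrit, hfree⟩ := hcon
  have hpair : ∀ τ ∈ K, τ.card = d + 1 → ∃ σ, (σ, τ) ∈ V := by
    intro τ hτ hc
    have hfacet : Facet K τ := ⟨hτ, fun ν hν hτν =>
      (Finset.eq_of_subset_of_card_le hτν (hc ▸ hbd ν hν)).symm⟩
    have hnc := hcrit τ hfacet hc
    simp only [CriticalForVF, not_forall] at hnc
    obtain ⟨q, hq, hne'⟩ := hnc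
    obtain ⟨-, hq2, -, hqc⟩ := hV.1 q hq
    have h₁ : τ ≠ q.1 := by
      rintro rfl
      have := hbd _ hq2
      omega
    have h₂ : τ = q.2 := by tauto
    exact ⟨q.1, h₂ ▸ hq⟩
  obtain ⟨τ₀, hτ₀, hτ₀c⟩ := htop
  obtain ⟨σ₀, hσ₀⟩ := hpair τ₀ hτ₀ hτ₀c
  have hd : d ≠ 0 := by
    rintro rfl
    obtain ⟨hσK, -, -, hc⟩ := hV.1 _ hσ₀
    have hempty : σ₀ = ∅ := Finset.card_eq_zero.mp (by simp only at hc; omega)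
    exact hK.1 (hempty ▸ hσK)
  obtain ⟨p, rfl⟩ := Nat.exists_eq_succ_of_ne_zero hd
  have hnext : ∀ q : {q : Finset α × Finset α // q ∈ V ∧ q.2.card = p + 2},
      ∃ r : {q : Finset α × Finset α // q ∈ V ∧ q.2.card = p + 2},
        q.1.1 ⊂ r.1.2 ∧ q.1.1 ≠ r.1.1 := by
    rintro ⟨⟨σ, τ⟩, hq, hc⟩
    obtain ⟨hσK, hτK, hστ, hσc⟩ := hV.1 _ hq
    simp only at hc hσK hτK hστ hσc
    have hss : σ ⊂ τ := hστ.ssubset_of_ne (by rintro rfl; omega)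
    have hnf := hfree σ τ hq hc
    simp only [FreePair, not_and, not_forall] at hnf
    obtain ⟨ν, hν, hσν, hντ⟩ := hnf hσK hτK hss
    have hνc : ν.card = p + 2 := by
      have h₁ := Finset.card_lt_card hσν
      have h₂ := hbd ν hν
      omega
    obtain ⟨σ', hσ'⟩ := hpair ν hν hνc
    refine ⟨⟨(σ', ν), hσ', hνc⟩, hσν, fun h => hντ ?_⟩
    exact (congrArg Prod.snd (hV.2 _ hq _ hσ' (Or.inl h))).symm
  choose f hf using hnext
  let s := fun n => f^[n] ⟨(σ₀, τ₀), hσ₀, hτ₀c⟩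
  refine hac.not_backward_sequence hV p (fun n => (s n).1) (fun n => (s n).2) fun n => ?_
  simpa only [s, Function.iterate_succ_apply'] using hf (s n)
end

section
/- If f is a Morse function on a simplicial complex K, then the gradient vector field of f is an acyclic discrete vector field on K. -/
/- Basic notions: simplicial complexes, facets, free pairs, expansions,
   fillings, collapses, Morse sequences, discrete vector fields,
   gradient paths, Morse functions. -/

variable {α : Type*} [DecidableEq α]

/-- A Morse function strictly decreases along each step of a gradient path. -/
lemma IsGradPath.morse_lt {β : Type*} {K : Finset (Finset β)} {f : Finset β → ℤ}
    (hf : IsMorseFunction K f) {p k : ℕ} {σ τ : ℕ → Finset β}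
    (h : IsGradPath K (Vf K f) p k σ τ) {i : ℕ} (hi : i < k) :
    f (σ (i + 1)) < f (σ i) := by
  obtain ⟨hσ, hτ, hV⟩ := h
  obtain ⟨hmem, hsub, hne⟩ := hV i hi
  refine lt_of_lt_of_le ?_ hmem.2.2.2
  by_contra! hle
  have hmem' : (σ (i + 1), τ i) ∈ Vf K f :=
    ⟨(hσ (i + 1) hi).1, (hτ i hi).1,
      ⟨hsub.subset, by rw [(hσ (i + 1) hi).2, (hτ i hi).2]⟩, hle⟩
  exact hne (congrArg Prod.fst (hf _ hmem' _ hmem (by simp)))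

/-- The gradient vector field of a Morse function has no non-trivial closed gradient path. -/
lemma acyclicVF_Vf {β : Type*} {K : Finset (Finset β)} {f : Finset β → ℤ}
    (hf : IsMorseFunction K f) :
    AcyclicVF K (Vf K f) := by
  intro p k σ τ h hk heq
  have hlt : ∀ j, 1 ≤ j → j ≤ k → f (σ j) < f (σ 0) := by
    intro j hj
    induction j, hj using Nat.le_induction with
    | base => exact fun hjk => h.morse_lt hf hjk
    | succ j _ ih => exact fun hjk => (h.morse_lt hf hjk).trans (ih (Nat.le_of_succ_le hjk))
  exact (hlt k hk le_rfl).ne (congrArg f heq.symm)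

/-- The gradient vector field of a Morse function on `K` is an acyclic
discrete vector field on `K`. -/
theorem gradient_of_morse_function_acyclic {α : Type*} [DecidableEq α]
    (K : Finset (Finset α)) (hK : IsComplex K)
    (f : Finset α → ℤ) (hf : IsMorseFunction K f) :
    IsDVF K (Vf K f) ∧ AcyclicVF K (Vf K f) := by
  exact ⟨⟨fun _ hp => ⟨hp.1, hp.2.1, hp.2.2.1⟩, hf⟩, acyclicVF_Vf hf⟩
end

section
/- Let f be a Morse function on a simplicial complex K with gradient vector field V(f), and let ⟨σ_0,τ_0,σ_1,τ_1,...,σ_{k−1},τ_{k−1},σ_k⟩ be a p-gradient path in V(f) with k ≥ 1. Then f(σ_0) > f(σ_k). In particular no such path is closed. -/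
/- Basic notions: simplicial complexes, facets, free pairs, expansions,
   fillings, collapses, Morse sequences, discrete vector fields,
   gradient paths, Morse functions. -/

variable {α : Type*} [DecidableEq α]

/-- If a Morse function pairs `σ` with `τ`, then it takes a smaller value than `f σ`
on every other codimension-one face of `τ`. -/
theorem IsMorseFunction.lt_of_mem_Vf {β : Type*} {K : Finset (Finset β)} {f : Finset β → ℤ}
    (hf : IsMorseFunction K f) {σ σ' τ : Finset β} (h : (σ, τ) ∈ Vf K f)
    (hσ' : σ' ∈ K) (hb : InBoundary σ' τ) (hne : σ' ≠ σ) : f σ' < f σ := by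
  refine lt_of_lt_of_le (lt_of_not_ge fun hle => hne ?_) h.2.2.2
  have h' : (σ', τ) ∈ Vf K f := ⟨hσ', h.2.1, hb, hle⟩
  exact congrArg Prod.fst (hf _ h' _ h (Or.inr (Or.inr (Or.inr rfl))))

/-- Along a nontrivial `p`-gradient path in the gradient vector field of
a Morse function `f`, the value of `f` strictly decreases from the first to the last
simplex; in particular no such path is closed. -/
theorem morse_function_decreases_along_path {α : Type*} [DecidableEq α]
    (K : Finset (Finset α)) (hK : IsComplex K)
    (f : Finset α → ℤ) (hf : IsMorseFunction K f)
    (p k : ℕ) (σ τ : ℕ → Finset α)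
    (hpath : IsGradPath K (Vf K f) p k σ τ) (hk : 1 ≤ k) :
    f (σ k) < f (σ 0) ∧ σ 0 ≠ σ k := by
  obtain ⟨hσ, hτ, hstep⟩ := hpath
  have hlt : ∀ i < k, f (σ (i + 1)) < f (σ i) := fun i hi =>
    hf.lt_of_mem_Vf (hstep i hi).1 (hσ (i + 1) hi).1
      ⟨(hstep i hi).2.1.subset, by rw [(hσ (i + 1) hi).2, (hτ i hi).2]⟩ (hstep i hi).2.2
  have hanti : ∀ n, 1 ≤ n → n ≤ k → f (σ n) < f (σ 0) := by
    intro n hn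
    induction n, hn using Nat.le_induction with
    | base => exact fun h => hlt 0 h
    | succ n _ ih => exact fun h => (hlt n h).trans (ih (Nat.le_of_succ_le h))
  have hk0 := hanti k hk le_rfl
  exact ⟨hk0, fun h => hk0.ne' (congrArg f h)⟩
end

section
/- Let W be a Morse sequence on a simplicial complex K. Then the canonical Morse function f of W is a Morse function on W, and moreover f is a basic Morse function on K: it is monotone (f(σ) ≤ f(τ) whenever σ ⊆ τ), semi-injective (each fiber f^{−1}(i) has cardinality at most 2), and generic (if f(σ) = f(τ) then σ ⊆ τ or τ ⊆ σ). -/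
/- Basic notions: simplicial complexes, facets, free pairs, expansions,
   fillings, collapses, Morse sequences, discrete vector fields,
   gradient paths, Morse functions. -/

variable {α : Type*} [DecidableEq α]

namespace MorseSequence

variable {K : Finset (Finset α)} (W : MorseSequence K)

theorem seq_subset_seq_succ {i : ℕ} (hi : i < W.k) : W.seq i ⊆ W.seq (i + 1) := by
  rcases W.step i hi with ⟨σ, τ, -, h⟩ | ⟨σ, -, h⟩
  · rw [h]
    exact Finset.sdiff_subset
  · rw [h]
    exact Finset.erase_subset _ _

theorem canonicalMF_le_iff {σ : Finset α} (hσ : σ ∈ K) {i : ℕ} (hi : i ≤ W.k) :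
    canonicalMF W σ ≤ i ↔ σ ∈ W.seq i := by
  have hne : {j : ℕ | σ ∈ W.seq j}.Nonempty := ⟨W.k, W.last.symm.subset hσ⟩
  rw [canonicalMF, Nat.cast_le]
  exact ⟨fun h => W.seq_subset_seq h hi (Nat.sInf_mem hne), fun h => Nat.sInf_le h⟩

theorem canonicalMF_eq_succ_iff {σ : Finset α} (hσ : σ ∈ K) {i : ℕ} (hi : i < W.k) :
    canonicalMF W σ = i + 1 ↔ σ ∈ W.seq (i + 1) ∧ σ ∉ W.seq i := by
  rw [← W.canonicalMF_le_iff hσ (Nat.succ_le_of_lt hi), ← W.canonicalMF_le_iff hσ hi.le]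
  push_cast
  lia

theorem exists_canonicalMF_eq_succ {σ : Finset α} (hσ : σ ∈ K) :
    ∃ i < W.k, canonicalMF W σ = i + 1 := by
  have hk : canonicalMF W σ ≤ W.k := (W.canonicalMF_le_iff hσ le_rfl).2 (W.last.symm.subset hσ)
  have h0 : ¬ canonicalMF W σ ≤ (0 : ℕ) := by
    rw [W.canonicalMF_le_iff hσ (Nat.zero_le _), W.first]
    exact Finset.notMem_empty σ
  exact ⟨(canonicalMF W σ - 1).toNat, by lia, by lia⟩

/-- The faces added at a given step of a Morse sequence are among two nested ones. -/
theorem exists_seq_succ_sdiff_subset_pair {i : ℕ} (hi : i < W.k) :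
    ∃ σ τ : Finset α, σ ⊆ τ ∧ W.seq (i + 1) \ W.seq i ⊆ {σ, τ} := by
  rcases W.step i hi with ⟨σ, τ, hfree, h⟩ | ⟨σ, -, h⟩
  · refine ⟨σ, τ, hfree.2.2.1.subset, fun ν hν => ?_⟩
    rw [h] at hν
    simp only [Finset.mem_sdiff] at hν
    tauto
  · refine ⟨σ, σ, subset_rfl, fun ν hν => ?_⟩
    rw [h] at hν
    simp only [Finset.mem_sdiff, Finset.mem_erase, Finset.mem_insert] at hν ⊢
    tauto

theorem seq_succ_subset {i : ℕ} (hi : i < W.k) : W.seq (i + 1) ⊆ K :=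
  (W.seq_subset_seq (Nat.succ_le_of_lt hi) le_rfl).trans W.last.subset

theorem nonempty_of_mem (W : MorseSequence K) {σ : Finset α} (hσ : σ ∈ K) : σ.Nonempty := by
  have h := (W.cplx W.k le_rfl).1
  rw [W.last] at h
  exact Finset.nonempty_iff_ne_empty.2 fun he => h (he ▸ hσ)

theorem isMorseFunctionOnSeq_canonicalMF : IsMorseFunctionOnSeq W (canonicalMF W) := by
  constructor
  · rintro σc ⟨i, hi, hmem, heq⟩ σ hσ ⟨hsub, hcard⟩
    have hc : canonicalMF W σc = i + 1 :=
      (W.canonicalMF_eq_succ_iff (W.seq_succ_subset hi hmem) hi).2 ⟨hmem, by simp [heq]⟩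
    have hne : σ ≠ σc := by
      rintro rfl
      lia
    have hσi : σ ∈ W.seq i := by
      rw [heq]
      exact Finset.mem_erase.2
        ⟨hne, (W.cplx (i + 1) hi).2 σc hmem σ (W.nonempty_of_mem hσ) hsub⟩
    have := (W.canonicalMF_le_iff hσ hi.le).2 hσi
    lia
  · rintro σ τ ⟨i, hi, ⟨hσ, hτ, -⟩, heq⟩
    rw [(W.canonicalMF_eq_succ_iff (W.seq_succ_subset hi hσ) hi).2 ⟨hσ, by simp [heq]⟩,
      (W.canonicalMF_eq_succ_iff (W.seq_succ_subset hi hτ) hi).2 ⟨hτ, by simp [heq]⟩]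

theorem isBasicMorseFunction_canonicalMF : IsBasicMorseFunction K (canonicalMF W) := by
  refine ⟨fun σ hσ τ hτ hsub => ?_, fun n => ?_, fun σ hσ τ hτ h => ?_⟩
  · obtain ⟨i, hi, hf⟩ := W.exists_canonicalMF_eq_succ hτ
    have hmem := ((W.canonicalMF_eq_succ_iff hτ hi).1 hf).1
    have := (W.canonicalMF_le_iff hσ hi).2
      ((W.cplx (i + 1) hi).2 τ hmem σ (W.nonempty_of_mem hσ) hsub)
    rw [hf]
    exact_mod_cast this
  · rcases (K.filter fun σ => canonicalMF W σ = n).eq_empty_or_nonempty with he | ⟨ρ, hρ⟩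
    · simp [he]
    · obtain ⟨hρK, rfl⟩ := Finset.mem_filter.1 hρ
      obtain ⟨i, hi, hf⟩ := W.exists_canonicalMF_eq_succ hρK
      obtain ⟨σ, τ, -, hsub⟩ := W.exists_seq_succ_sdiff_subset_pair hi
      refine (Finset.card_le_card fun ν hν => hsub ?_).trans (Finset.card_le_two (a := σ) (b := τ))
      obtain ⟨hνK, hν⟩ := Finset.mem_filter.1 hν
      exact Finset.mem_sdiff.2 ((W.canonicalMF_eq_succ_iff hνK hi).1 (hν.trans hf))
  · obtain ⟨i, hi, hf⟩ := W.exists_canonicalMF_eq_succ hτ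
    obtain ⟨μ, ν, hμν, hsub⟩ := W.exists_seq_succ_sdiff_subset_pair hi
    have hσ' := hsub (Finset.mem_sdiff.2 ((W.canonicalMF_eq_succ_iff hσ hi).1 (h.trans hf)))
    have hτ' := hsub (Finset.mem_sdiff.2 ((W.canonicalMF_eq_succ_iff hτ hi).1 hf))
    simp only [Finset.mem_insert, Finset.mem_singleton] at hσ' hτ'
    rcases hσ' with rfl | rfl <;> rcases hτ' with rfl | rfl <;> simp [hμν]

end MorseSequence

/-- The canonical Morse function of a Morse sequence `W` on `K` is a
Morse function on `W`, and it is a basic Morse function on `K` (monotone,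
semi-injective, generic). -/
theorem canonical_morse_function_basic {α : Type*} [DecidableEq α]
    (K : Finset (Finset α)) (W : MorseSequence K) :
    IsMorseFunctionOnSeq W (canonicalMF W) ∧
    IsBasicMorseFunction K (canonicalMF W) :=
  ⟨W.isMorseFunctionOnSeq_canonicalMF, W.isBasicMorseFunction_canonicalMF⟩
end

section
/- Let f be a basic Morse function on a simplicial complex K. If the simplexes of K are enumerated by increasing values of f, with each fiber f^{−1}(i) of cardinality one contributing a single simplex and each fiber f^{−1}(i) of cardinality two contributing a pair, then the resulting sequence of complexes is a Morse sequence on K: singleton fibers give critical faces (fillings) and two-element fibers give regular pairs (expansions). -/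
/- Basic notions: simplicial complexes, facets, free pairs, expansions,
   fillings, collapses, Morse sequences, discrete vector fields,
   gradient paths, Morse functions. -/

variable {α : Type*} [DecidableEq α]

/-- The sublevel sets of a monotone function on a complex are complexes. -/
theorem IsComplex.filter_le {β : Type*} {K : Finset (Finset β)} (hK : IsComplex K)
    {f : Finset β → ℤ}
    (hf : ∀ σ ∈ K, ∀ τ ∈ K, σ ⊆ τ → f σ ≤ f τ) (c : ℤ) :
    IsComplex (K.filter fun σ => f σ ≤ c) := by
  refine ⟨fun h => hK.1 (Finset.mem_filter.1 h).1, fun τ hτ σ hσ hστ => ?_⟩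
  obtain ⟨hτK, hτc⟩ := Finset.mem_filter.1 hτ
  have hσK := hK.2 τ hτK σ hσ hστ
  exact Finset.mem_filter.2 ⟨hσK, (hf σ hσK τ hτK hστ).trans hτc⟩

/-- Crossing a fiber with one element is an elementary filling. -/
theorem elemFilling_filter_lt_filter_le {K : Finset (Finset α)} {f : Finset α → ℤ}
    (hf : ∀ σ ∈ K, ∀ τ ∈ K, σ ⊆ τ → f σ ≤ f τ) {c : ℤ}
    (hc : (K.filter fun σ => f σ = c).card = 1) :
    ElemFilling (K.filter fun σ => f σ < c) (K.filter fun σ => f σ ≤ c) := by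
  obtain ⟨σ, hσ⟩ := Finset.card_eq_one.1 hc
  have hmem : ∀ ν, (ν ∈ K ∧ f ν = c) ↔ ν = σ := fun ν => by
    simpa using Finset.ext_iff.1 hσ ν
  obtain ⟨hσK, hσc⟩ := (hmem σ).2 rfl
  refine ⟨σ, ⟨Finset.mem_filter.2 ⟨hσK, hσc.le⟩, fun ν hν hσν => ?_⟩, ?_⟩
  · obtain ⟨hνK, hνc⟩ := Finset.mem_filter.1 hν
    exact (hmem ν).1 ⟨hνK, le_antisymm hνc (hσc ▸ hf σ hσK ν hνK hσν)⟩
  · ext ν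
    simp only [Finset.mem_filter, Finset.mem_erase, ne_eq, ← hmem ν, lt_iff_le_and_ne]
    tauto

/-- Crossing a fiber with two comparable elements is an elementary expansion. -/
theorem elemExpansion_filter_lt_filter_le {K : Finset (Finset α)} {f : Finset α → ℤ}
    (hf : ∀ σ ∈ K, ∀ τ ∈ K, σ ⊆ τ → f σ ≤ f τ)
    (hgen : ∀ σ ∈ K, ∀ τ ∈ K, f σ = f τ → σ ⊆ τ ∨ τ ⊆ σ) {c : ℤ}
    (hc : (K.filter fun σ => f σ = c).card = 2) :
    ElemExpansion (K.filter fun σ => f σ < c) (K.filter fun σ => f σ ≤ c) := by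
  obtain ⟨σ, τ, hστ, hfib⟩ : ∃ σ τ, σ ⊂ τ ∧ (K.filter fun σ => f σ = c) = {σ, τ} := by
    obtain ⟨σ, τ, hne, hfib⟩ := Finset.card_eq_two.1 hc
    obtain ⟨hσK, hσc⟩ : σ ∈ K ∧ f σ = c := by
      simpa using Finset.ext_iff.1 hfib σ
    obtain ⟨hτK, hτc⟩ : τ ∈ K ∧ f τ = c := by
      simpa using Finset.ext_iff.1 hfib τ
    rcases hgen σ hσK τ hτK (hσc.trans hτc.symm) with h | h
    · exact ⟨σ, τ, h.ssubset_of_ne hne, hfib⟩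
    · exact ⟨τ, σ, h.ssubset_of_ne hne.symm, hfib.trans (Finset.pair_comm σ τ)⟩
  have hmem : ∀ ν, (ν ∈ K ∧ f ν = c) ↔ ν = σ ∨ ν = τ := fun ν => by
    simpa using Finset.ext_iff.1 hfib ν
  obtain ⟨hσK, hσc⟩ := (hmem σ).2 (Or.inl rfl)
  obtain ⟨hτK, hτc⟩ := (hmem τ).2 (Or.inr rfl)
  refine ⟨σ, τ, ⟨Finset.mem_filter.2 ⟨hσK, hσc.le⟩, Finset.mem_filter.2 ⟨hτK, hτc.le⟩, hστ,
    fun ν hν hσν => ?_⟩, ?_⟩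
  · obtain ⟨hνK, hνc⟩ := Finset.mem_filter.1 hν
    exact ((hmem ν).1 ⟨hνK, le_antisymm hνc (hσc ▸ hf σ hσK ν hνK hσν.subset)⟩).resolve_left
      hσν.ne'
  · ext ν
    simp only [Finset.mem_filter, Finset.mem_sdiff, Finset.mem_insert, Finset.mem_singleton,
      ← hmem ν, lt_iff_le_and_ne]
    tauto

/-- Enumerating the simplexes of `K` by increasing values of a basic
Morse function `f` (distinct values `v 1 < ⋯ < v m`, sublevel complexes `Kseq j`)
yields a Morse sequence on `K`: singleton fibers give elementary fillings (critical
faces) and two-element fibers give elementary expansions (regular pairs). -/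
theorem basic_morse_function_gives_morse_sequence {α : Type*} [DecidableEq α]
    (K : Finset (Finset α)) (hK : IsComplex K)
    (f : Finset α → ℤ) (hf : IsBasicMorseFunction K f)
    (m : ℕ) (v : ℕ → ℤ)
    (hmono : ∀ i j : ℕ, 1 ≤ i → i < j → j ≤ m → v i < v j)
    (hvals : ∀ j : ℕ, 1 ≤ j → j ≤ m → ∃ σ ∈ K, f σ = v j)
    (hsurj : ∀ σ ∈ K, ∃ j : ℕ, 1 ≤ j ∧ j ≤ m ∧ f σ = v j)
    (Kseq : ℕ → Finset (Finset α))
    (h0 : Kseq 0 = ∅)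
    (hsub : ∀ j : ℕ, 1 ≤ j → j ≤ m → Kseq j = K.filter (fun σ => f σ ≤ v j)) :
    Kseq m = K ∧
    (∀ j : ℕ, 1 ≤ j → j ≤ m →
      ((K.filter (fun σ => f σ = v j)).card = 1 → ElemFilling (Kseq (j - 1)) (Kseq j)) ∧
      ((K.filter (fun σ => f σ = v j)).card = 2 → ElemExpansion (Kseq (j - 1)) (Kseq j))) ∧
    ∃ W : MorseSequence K, W.k = m ∧ ∀ j ≤ m, W.seq j = Kseq j := by
  obtain ⟨hf_mono, hf_card, hf_gen⟩ := hf
  have hv_le : ∀ i j, 1 ≤ i → i ≤ j → j ≤ m → v i ≤ v j := fun i j hi hij hj =>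
    hij.eq_or_lt.elim (fun h => h ▸ le_rfl) fun h => (hmono i j hi h hj).le
  have hlast : Kseq m = K := by
    rcases Nat.eq_zero_or_pos m with rfl | hm
    · rw [h0, eq_comm, Finset.eq_empty_iff_forall_notMem]
      intro σ hσ
      obtain ⟨j, h1, h2, -⟩ := hsurj σ hσ
      omega
    · rw [hsub m hm le_rfl, Finset.filter_eq_self]
      intro σ hσ
      obtain ⟨j, h1, h2, hj⟩ := hsurj σ hσ
      exact hj ▸ hv_le j m h1 h2 le_rfl
  have hpred : ∀ j, 1 ≤ j → j ≤ m → Kseq (j - 1) = K.filter fun σ => f σ < v j := by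
    intro j h1 hj
    rcases h1.eq_or_lt with rfl | h1'
    · rw [h0, eq_comm, Finset.filter_eq_empty_iff]
      intro σ hσ
      obtain ⟨i, hi1, him, hi⟩ := hsurj σ hσ
      exact hi ▸ (hv_le 1 i le_rfl hi1 him).not_gt
    · rw [hsub (j - 1) (by omega) (by omega)]
      refine Finset.filter_congr fun σ hσ => ?_
      obtain ⟨i, hi1, him, hi⟩ := hsurj σ hσ
      rw [hi]
      refine ⟨fun h => h.trans_lt (hmono _ _ (by omega) (by omega) hj), fun h => ?_⟩
      have hij : i < j := lt_of_not_ge fun hji => (hv_le j i h1 hji him).not_gt h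
      exact hv_le i (j - 1) hi1 (by omega) (by omega)
  have hsteps : ∀ j : ℕ, 1 ≤ j → j ≤ m →
      ((K.filter (fun σ => f σ = v j)).card = 1 → ElemFilling (Kseq (j - 1)) (Kseq j)) ∧
      ((K.filter (fun σ => f σ = v j)).card = 2 → ElemExpansion (Kseq (j - 1)) (Kseq j)) := by
    intro j h1 hj
    rw [hpred j h1 hj, hsub j h1 hj]
    exact ⟨elemFilling_filter_lt_filter_le hf_mono,
      elemExpansion_filter_lt_filter_le hf_mono hf_gen⟩
  refine ⟨hlast, hsteps, ⟨m, Kseq, fun i hi => ?_, h0, hlast, fun i hi => ?_⟩, rfl, fun _ _ => rfl⟩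
  · rcases Nat.eq_zero_or_pos i with rfl | hpos
    · rw [h0]
      simp [IsComplex]
    · rw [hsub i hpos hi]
      exact hK.filter_le hf_mono _
  · obtain ⟨hfill, hexp⟩ := hsteps (i + 1) (by omega) hi
    obtain ⟨σ, hσ, hσv⟩ := hvals (i + 1) (by omega) hi
    have hpos : 0 < (K.filter fun σ => f σ = v (i + 1)).card :=
      Finset.card_pos.2 ⟨σ, Finset.mem_filter.2 ⟨hσ, hσv⟩⟩
    have hle := hf_card (v (i + 1))
    rcases (by omega : (K.filter fun σ => f σ = v (i + 1)).card = 1 ∨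
      (K.filter fun σ => f σ = v (i + 1)).card = 2) with h | h
    · exact Or.inr (hfill h)
    · exact Or.inl (hexp h)
end

section
/- Let f be a basic Morse function on a simplicial complex K. Then there exists one and only one Morse sequence W on K such that the canonical Morse function of W is strongly equivalent to f. -/
/- Basic notions: simplicial complexes, facets, free pairs, expansions,
   fillings, collapses, Morse sequences, discrete vector fields,
   gradient paths, Morse functions. -/

variable {α : Type*} [DecidableEq α]

/-- The position of `f σ` among the values taken by `f` on `K`, counted from `1`. -/
def valueRank (K : Finset (Finset α)) (f : Finset α → ℤ) (σ : Finset α) : ℕ :=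
  ((K.filter fun τ => f τ ≤ f σ).image f).card

section Rank

variable {β : Type*} {K : Finset (Finset β)} {f g : Finset β → ℤ} {σ τ : Finset β}

theorem card_image_le_card_image_of_factors {ι κ γ : Type*} [DecidableEq κ] [DecidableEq γ]
    {S : Finset ι} {f : ι → κ} {g : ι → γ}
    (h : ∀ a ∈ S, ∀ b ∈ S, f a = f b → g a = g b) :
    (S.image g).card ≤ (S.image f).card := by
  rcases S.eq_empty_or_nonempty with rfl | ⟨a₀, -⟩
  · simp
  have : Nonempty γ := ⟨g a₀⟩
  have hex : ∀ v ∈ S.image f, ∃ w, ∀ a ∈ S, f a = v → g a = w := by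
    intro v hv
    obtain ⟨b, hb, rfl⟩ := Finset.mem_image.1 hv
    exact ⟨g b, fun a ha hab => h a ha b hb hab⟩
  choose! e he using hex
  have himage : S.image g ⊆ (S.image f).image e := by
    intro w hw
    obtain ⟨a, ha, rfl⟩ := Finset.mem_image.1 hw
    have hfa := Finset.mem_image_of_mem f ha
    exact Finset.mem_image.2 ⟨f a, hfa, (he _ hfa a ha rfl).symm⟩
  exact (Finset.card_le_card himage).trans Finset.card_image_le

theorem StronglyEquiv.eq_iff (h : StronglyEquiv K f g) (hσ : σ ∈ K) (hτ : τ ∈ K) :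
    f σ = f τ ↔ g σ = g τ := by
  rw [le_antisymm_iff, le_antisymm_iff, h σ hσ τ hτ, h τ hτ σ hσ]

theorem StronglyEquiv.card_image_eq (h : StronglyEquiv K f g) {S : Finset (Finset β)}
    (hS : S ⊆ K) : (S.image f).card = (S.image g).card :=
  le_antisymm
    (card_image_le_card_image_of_factors fun _ ha _ hb => (h.eq_iff (hS ha) (hS hb)).2)
    (card_image_le_card_image_of_factors fun _ ha _ hb => (h.eq_iff (hS ha) (hS hb)).1)

theorem StronglyEquiv.valueRank_eq (h : StronglyEquiv K f g) (hσ : σ ∈ K) :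
    valueRank K f σ = valueRank K g σ := by
  unfold valueRank
  rw [h.card_image_eq (Finset.filter_subset _ _),
    Finset.filter_congr fun τ hτ => h τ hτ σ hσ]

theorem valueRank_le_valueRank_iff (hσ : σ ∈ K) :
    valueRank K f σ ≤ valueRank K f τ ↔ f σ ≤ f τ := by
  constructor
  · contrapose!
    intro h
    refine Finset.card_lt_card (Finset.ssubset_iff_of_subset ?_ |>.2 ⟨f σ, ?_, ?_⟩)
    · refine Finset.image_subset_image fun ν hν => ?_
      rw [Finset.mem_filter] at hν ⊢
      exact ⟨hν.1, hν.2.trans h.le⟩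
    · exact Finset.mem_image_of_mem f (Finset.mem_filter.2 ⟨hσ, le_rfl⟩)
    · intro hmem
      obtain ⟨ν, hν, hfν⟩ := Finset.mem_image.1 hmem
      have := (Finset.mem_filter.1 hν).2
      omega
  · intro h
    refine Finset.card_le_card (Finset.image_subset_image fun ν hν => ?_)
    rw [Finset.mem_filter] at hν ⊢
    exact ⟨hν.1, hν.2.trans h⟩

theorem valueRank_eq_iff (hσ : σ ∈ K) (hτ : τ ∈ K) :
    valueRank K f σ = valueRank K f τ ↔ f σ = f τ := by
  rw [le_antisymm_iff, le_antisymm_iff, valueRank_le_valueRank_iff hσ,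
    valueRank_le_valueRank_iff hτ]

theorem valueRank_pos (hσ : σ ∈ K) : 0 < valueRank K f σ :=
  Finset.card_pos.2 ⟨f σ, Finset.mem_image_of_mem f (Finset.mem_filter.2 ⟨hσ, le_rfl⟩)⟩

theorem valueRank_le_card_image : valueRank K f σ ≤ (K.image f).card :=
  Finset.card_le_card (Finset.image_subset_image (Finset.filter_subset _ _))

theorem exists_valueRank_eq {i : ℕ} (hi : 0 < i) (hi' : i ≤ (K.image f).card) :
    ∃ σ ∈ K, valueRank K f σ = i := by
  have hsub : K.image (valueRank K f) ⊆ Finset.Icc 1 (K.image f).card := by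
    intro j hj
    obtain ⟨σ, hσ, rfl⟩ := Finset.mem_image.1 hj
    exact Finset.mem_Icc.2 ⟨valueRank_pos hσ, valueRank_le_card_image⟩
  have hcard : (K.image f).card ≤ (K.image (valueRank K f)).card :=
    card_image_le_card_image_of_factors fun _ hσ _ hτ =>
      (valueRank_eq_iff hσ hτ).1
  have himage : K.image (valueRank K f) = Finset.Icc 1 (K.image f).card :=
    Finset.eq_of_subset_of_card_le hsub (by simpa using hcard)
  exact Finset.mem_image.1 (himage ▸ Finset.mem_Icc.2 ⟨hi, hi'⟩)

end Rank

section Existence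

variable {K : Finset (Finset α)} {f : Finset α → ℤ}

theorem IsBasicMorseFunction.elemFilling_or_elemExpansion (hf : IsBasicMorseFunction K f) {i : ℕ}
    (hi : i < (K.image f).card) :
    ElemExpansion (K.filter fun σ => valueRank K f σ ≤ i)
        (K.filter fun σ => valueRank K f σ ≤ i + 1) ∨
      ElemFilling (K.filter fun σ => valueRank K f σ ≤ i)
        (K.filter fun σ => valueRank K f σ ≤ i + 1) := by
  obtain ⟨hmono, hcard, hgen⟩ := hf
  obtain ⟨σ, hσ, hσi⟩ := exists_valueRank_eq (f := f) i.succ_pos hi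
  have hup : ∀ μ ∈ K, f μ = f σ → ∀ ν ∈ K, valueRank K f ν ≤ i + 1 → μ ⊆ ν → f ν = f σ := by
    intro μ hμ hμσ ν hν hνi hμν
    refine le_antisymm ?_ (hμσ ▸ hmono μ hμ ν hν hμν)
    exact (valueRank_le_valueRank_iff hν).1 (hνi.trans hσi.ge)
  have hfib : ∀ ν ∈ K, (f ν = f σ ↔ valueRank K f ν = i + 1) := by
    intro ν hν
    rw [← valueRank_eq_iff hν hσ, hσi]
  by_cases hex : ∃ τ ∈ K, f τ = f σ ∧ τ ≠ σ
  · left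
    obtain ⟨τ, hτ, hτσ, hne⟩ := hex
    have hpair : ∀ ν ∈ K, f ν = f σ → ν = σ ∨ ν = τ := by
      intro ν hν hνσ
      by_contra! h
      have hsub : ({σ, τ, ν} : Finset (Finset α)) ⊆ K.filter fun μ => f μ = f σ := by
        intro μ hμ
        simp only [Finset.mem_insert, Finset.mem_singleton] at hμ
        rcases hμ with rfl | rfl | rfl <;> simp [*]
      have h3 : ({σ, τ, ν} : Finset (Finset α)).card = 3 :=
        Finset.card_eq_three.2 ⟨σ, τ, ν, hne.symm, h.1.symm, h.2.symm, rfl⟩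
      have := (Finset.card_le_card hsub).trans (hcard (f σ))
      omega
    have key : ∀ μ ν, μ ∈ K → ν ∈ K → f μ = f σ → f ν = f σ → μ ⊂ ν →
        (∀ ρ ∈ K, f ρ = f σ → ρ = μ ∨ ρ = ν) →
        ElemExpansion (K.filter fun σ => valueRank K f σ ≤ i)
          (K.filter fun σ => valueRank K f σ ≤ i + 1) := by
      intro μ ν hμ hν hμσ hνσ hμν hall
      have hμi := (hfib μ hμ).1 hμσ
      have hνi := (hfib ν hν).1 hνσ
      refine ⟨μ, ν, ⟨Finset.mem_filter.2 ⟨hμ, hμi.le⟩, Finset.mem_filter.2 ⟨hν, hνi.le⟩, hμν, ?_⟩,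
        ?_⟩
      · intro ρ hρ hμρ
        obtain ⟨hρ, hρi⟩ := Finset.mem_filter.1 hρ
        exact (hall ρ hρ (hup μ hμ hμσ ρ hρ hρi hμρ.1)).resolve_left hμρ.ne'
      · ext ρ
        simp only [Finset.mem_filter, Finset.mem_sdiff, Finset.mem_insert, Finset.mem_singleton]
        constructor
        · rintro ⟨hρ, hρi⟩
          refine ⟨⟨hρ, by omega⟩, ?_⟩
          rintro (rfl | rfl) <;> omega
        · rintro ⟨⟨hρ, hρi⟩, hρn⟩
          have : valueRank K f ρ ≠ i + 1 := fun h => hρn (hall ρ hρ ((hfib ρ hρ).2 h))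
          exact ⟨hρ, by omega⟩
    rcases hgen σ hσ τ hτ hτσ.symm with h | h
    · exact key σ τ hσ hτ rfl hτσ (h.ssubset_of_ne hne.symm) hpair
    · exact key τ σ hτ hσ hτσ rfl (h.ssubset_of_ne hne) fun ρ hρ hρσ => (hpair ρ hρ hρσ).symm
  · right
    push Not at hex
    refine ⟨σ, ⟨Finset.mem_filter.2 ⟨hσ, hσi.le⟩, ?_⟩, ?_⟩
    · intro ν hν hσν
      obtain ⟨hν, hνi⟩ := Finset.mem_filter.1 hν
      exact hex ν hν (hup σ hσ rfl ν hν hνi hσν)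
    · ext ρ
      simp only [Finset.mem_filter, Finset.mem_erase]
      constructor
      · rintro ⟨hρ, hρi⟩
        exact ⟨by rintro rfl; omega, hρ, by omega⟩
      · rintro ⟨hρn, hρ, hρi⟩
        have : valueRank K f ρ ≠ i + 1 := fun h => hρn (hex ρ hρ ((hfib ρ hρ).2 h))
        exact ⟨hρ, by omega⟩

/-- The Morse sequence formed by the sublevel complexes of a basic Morse function. -/
def sublevelMorseSequence (hK : IsComplex K) (hf : IsBasicMorseFunction K f) :
    MorseSequence K where
  k := (K.image f).card
  seq i := K.filter fun σ => valueRank K f σ ≤ i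
  cplx i _ := by
    refine ⟨fun h => hK.1 (Finset.mem_filter.1 h).1, fun τ hτ σ hne hστ => ?_⟩
    obtain ⟨hτ, hτi⟩ := Finset.mem_filter.1 hτ
    have hσ := hK.2 τ hτ σ hne hστ
    exact Finset.mem_filter.2
      ⟨hσ, ((valueRank_le_valueRank_iff hσ).2 (hf.1 σ hσ τ hτ hστ)).trans hτi⟩
  first := Finset.filter_false_of_mem fun _ hσ => (valueRank_pos hσ).not_ge
  last := Finset.filter_true_of_mem fun _ _ => valueRank_le_card_image
  step _ hi := hf.elemFilling_or_elemExpansion hi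

theorem canonicalMF_sublevelMorseSequence (hK : IsComplex K) (hf : IsBasicMorseFunction K f)
    {σ : Finset α} (hσ : σ ∈ K) :
    canonicalMF (sublevelMorseSequence hK hf) σ = valueRank K f σ := by
  have hset : {i | σ ∈ (sublevelMorseSequence hK hf).seq i} = Set.Ici (valueRank K f σ) := by
    ext i
    simp [sublevelMorseSequence, hσ]
  rw [canonicalMF, hset, csInf_Ici]

end Existence

namespace MorseSequence

variable {K : Finset (Finset α)} (W : MorseSequence K)

theorem seq_ssubset_seq_succ {i : ℕ} (hi : i < W.k) : W.seq i ⊂ W.seq (i + 1) := by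
  rcases W.step i hi with ⟨σ, τ, h, heq⟩ | ⟨σ, h, heq⟩ <;> rw [heq]
  · refine Finset.ssubset_iff_of_subset Finset.sdiff_subset |>.2 ⟨σ, h.1, by simp⟩
  · exact Finset.erase_ssubset h.1

theorem mem_seq_iff {i : ℕ} (hi : i ≤ W.k) {σ : Finset α} (hσ : σ ∈ K) :
    σ ∈ W.seq i ↔ canonicalMF W σ ≤ i := by
  rw [canonicalMF, Nat.cast_le]
  refine ⟨fun h => Nat.sInf_le h, fun h => W.seq_subset_seq h hi ?_⟩
  exact Nat.sInf_mem (s := {i | σ ∈ W.seq i}) ⟨W.k, by simpa [W.last] using hσ⟩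

theorem canonicalMF_mem_Icc {σ : Finset α} (hσ : σ ∈ K) :
    canonicalMF W σ ∈ Finset.Icc (1 : ℤ) W.k := by
  have h0 := W.mem_seq_iff (Nat.zero_le _) hσ
  have hk := W.mem_seq_iff le_rfl hσ
  rw [W.first] at h0
  rw [W.last] at hk
  simp only [Finset.notMem_empty, false_iff, Nat.cast_zero, not_le] at h0
  exact Finset.mem_Icc.2 ⟨h0, hk.1 hσ⟩

theorem exists_canonicalMF_eq {j : ℤ} (hj : j ∈ Finset.Icc (1 : ℤ) W.k) :
    ∃ σ ∈ K, canonicalMF W σ = j := by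
  obtain ⟨h1, hk⟩ := Finset.mem_Icc.1 hj
  obtain ⟨i, rfl⟩ : ∃ i : ℕ, j = (i + 1 : ℕ) := ⟨(j - 1).toNat, by omega⟩
  have hi : i < W.k := by omega
  obtain ⟨σ, hσ, hσi⟩ := Finset.exists_of_ssubset (W.seq_ssubset_seq_succ hi)
  have hσK : σ ∈ K := by
    rw [← W.last]
    exact W.seq_subset_seq hi le_rfl hσ
  rw [W.mem_seq_iff hi hσK] at hσ
  rw [W.mem_seq_iff hi.le hσK] at hσi
  exact ⟨σ, hσK, by omega⟩

theorem card_image_canonicalMF : (K.image (canonicalMF W)).card = W.k := by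
  have himage : K.image (canonicalMF W) = Finset.Icc (1 : ℤ) W.k := by
    ext j
    rw [Finset.mem_image]
    refine ⟨?_, W.exists_canonicalMF_eq⟩
    rintro ⟨σ, hσ, rfl⟩
    exact W.canonicalMF_mem_Icc hσ
  simp [himage]

theorem valueRank_canonicalMF {σ : Finset α} (hσ : σ ∈ K) :
    (valueRank K (canonicalMF W) σ : ℤ) = canonicalMF W σ := by
  obtain ⟨h1, hk⟩ := Finset.mem_Icc.1 (W.canonicalMF_mem_Icc hσ)
  have himage : (K.filter fun τ => canonicalMF W τ ≤ canonicalMF W σ).image (canonicalMF W) =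
      Finset.Icc 1 (canonicalMF W σ) := by
    ext j
    simp only [Finset.mem_image, Finset.mem_filter]
    constructor
    · rintro ⟨τ, ⟨hτ, hle⟩, rfl⟩
      exact Finset.mem_Icc.2 ⟨(Finset.mem_Icc.1 (W.canonicalMF_mem_Icc hτ)).1, hle⟩
    · intro hj
      obtain ⟨hj1, hjσ⟩ := Finset.mem_Icc.1 hj
      obtain ⟨τ, hτ, rfl⟩ := W.exists_canonicalMF_eq (Finset.mem_Icc.2 ⟨hj1, hjσ.trans hk⟩)
      exact ⟨τ, ⟨hτ, hjσ⟩, rfl⟩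
  rw [valueRank, himage, Int.card_Icc]
  omega

variable {W} {f : Finset α → ℤ}

theorem k_eq_card_image (h : StronglyEquiv K (canonicalMF W) f) : W.k = (K.image f).card := by
  rw [← W.card_image_canonicalMF, h.card_image_eq subset_rfl]

theorem seq_eq_filter_valueRank (h : StronglyEquiv K (canonicalMF W) f) {i : ℕ} (hi : i ≤ W.k) :
    W.seq i = K.filter fun σ => valueRank K f σ ≤ i := by
  have hsub : W.seq i ⊆ K := by
    simpa only [W.last] using W.seq_subset_seq hi le_rfl
  ext σ
  rw [Finset.mem_filter]
  have hiff : ∀ hσ : σ ∈ K, (σ ∈ W.seq i ↔ valueRank K f σ ≤ i) := fun hσ => by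
    rw [W.mem_seq_iff hi hσ, ← h.valueRank_eq hσ, ← W.valueRank_canonicalMF hσ, Nat.cast_le]
  exact ⟨fun hσ => ⟨hsub hσ, (hiff (hsub hσ)).1 hσ⟩, fun hσ => (hiff hσ.1).2 hσ.2⟩

end MorseSequence

/-- For a basic Morse function `f` on `K`, there is one and only one
Morse sequence on `K` whose canonical Morse function is strongly equivalent to `f`. -/
theorem unique_morse_sequence_of_basic_morse_function {α : Type*} [DecidableEq α]
    (K : Finset (Finset α)) (hK : IsComplex K)
    (f : Finset α → ℤ) (hf : IsBasicMorseFunction K f) :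
    (∃ W : MorseSequence K, StronglyEquiv K (canonicalMF W) f) ∧
    (∀ W W' : MorseSequence K, StronglyEquiv K (canonicalMF W) f →
      StronglyEquiv K (canonicalMF W') f →
      W.k = W'.k ∧ ∀ i ≤ W.k, W.seq i = W'.seq i) := by
  refine ⟨⟨sublevelMorseSequence hK hf, fun σ hσ τ hτ => ?_⟩, fun W W' h h' => ?_⟩
  · rw [canonicalMF_sublevelMorseSequence hK hf hσ, canonicalMF_sublevelMorseSequence hK hf hτ,
      Nat.cast_le, valueRank_le_valueRank_iff hσ]
  · have hk : W.k = W'.k := by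
      rw [MorseSequence.k_eq_card_image h, MorseSequence.k_eq_card_image h']
    refine ⟨hk, fun i hi => ?_⟩
    rw [MorseSequence.seq_eq_filter_valueRank h hi,
      MorseSequence.seq_eq_filter_valueRank h' (hk ▸ hi)]
end

section
/- Let K be a nonempty simplicial complex. If there exists a Morse sequence W on K having exactly one critical face, then that face is a 0-simplex and K is collapsible, i.e., K collapses onto a complex consisting of a single vertex. -/
/- Basic notions: simplicial complexes, facets, free pairs, expansions,
   fillings, collapses, Morse sequences, discrete vector fields,
   gradient paths, Morse functions. -/

variable {α : Type*} [DecidableEq α]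

theorem ElemExpansion.subset {α : Type*} [DecidableEq α] {L K : Finset (Finset α)}
    (h : ElemExpansion L K) : L ⊆ K := by
  obtain ⟨σ, τ, -, rfl⟩ := h
  exact Finset.sdiff_subset

/-- No complex is an elementary expansion of the empty complex. -/
theorem IsComplex.not_elemExpansion_empty {α : Type*} [DecidableEq α] {K : Finset (Finset α)}
    (hK : IsComplex K) : ¬ ElemExpansion ∅ K := by
  rintro ⟨σ, τ, ⟨hσ, hτ, hστ, -⟩, h⟩
  have hσne : σ.Nonempty := Finset.nonempty_iff_ne_empty.2 fun h0 => hK.1 (h0 ▸ hσ)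
  obtain ⟨x, hx⟩ := hσne
  obtain ⟨y, hy, hyσ⟩ := Finset.exists_of_ssubset hστ
  have hd : τ \ σ ∈ K := hK.2 τ hτ _ ⟨y, by simp [hy, hyσ]⟩ Finset.sdiff_subset
  have hmem : τ \ σ ∈ ({σ, τ} : Finset (Finset α)) :=
    Finset.sdiff_eq_empty_iff_subset.1 h.symm hd
  have hxd : x ∉ τ \ σ := by simp [hx]
  rcases Finset.mem_insert.1 hmem with h1 | h1
  · exact hxd (h1.symm.subset hx)
  · exact hxd ((Finset.mem_singleton.1 h1).symm.subset (hστ.1 hx))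

/-- An elementary filling of the empty complex is a single vertex. -/
theorem IsComplex.eq_singleton_of_elemFilling_empty {α : Type*} [DecidableEq α]
    {K : Finset (Finset α)} (hK : IsComplex K) (h : ElemFilling ∅ K) :
    ∃ a : α, K = {{a}} := by
  obtain ⟨σ, ⟨hσ, -⟩, h⟩ := h
  have hKσ : ∀ ν ∈ K, ν = σ := fun ν hν => by
    by_contra hne
    exact Finset.notMem_empty ν (h ▸ Finset.mem_erase.2 ⟨hne, hν⟩)
  obtain ⟨a, ha⟩ : σ.Nonempty := Finset.nonempty_iff_ne_empty.2 fun h0 => hK.1 (h0 ▸ hσ)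
  have haK : {a} ∈ K := hK.2 σ hσ {a} ⟨a, by simp⟩ (by simpa using ha)
  refine ⟨a, Finset.eq_singleton_iff_unique_mem.2 ⟨haK, fun ν hν => ?_⟩⟩
  rw [hKσ ν hν, hKσ _ haK]

/-- If a nonempty complex `K` has a Morse sequence with exactly one
critical face, then that face is a `0`-simplex and `K` is collapsible. -/
theorem single_critical_implies_collapsible {α : Type*} [DecidableEq α]
    (K : Finset (Finset α)) (hne : K.Nonempty)
    (W : MorseSequence K) (hcrit : ∃! σ : Finset α, CriticalFace W σ) :
    (∀ σ : Finset α, CriticalFace W σ → σ.card = 1) ∧ Collapsible K := by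
  have hk : 0 < W.k := by
    refine Nat.pos_of_ne_zero fun h0 => hne.ne_empty ?_
    rw [← W.last, h0, W.first]
  have hcplx := W.cplx 1 hk
  have hstep := W.step 0 hk
  rw [W.first] at hstep
  obtain ⟨a, ha⟩ := hcplx.eq_singleton_of_elemFilling_empty
    (hstep.resolve_left hcplx.not_elemExpansion_empty)
  have hacrit : CriticalFace W {a} := ⟨0, hk, by simp [ha], by simp [ha, W.first]⟩
  have huniq : ∀ σ, CriticalFace W σ → σ = {a} := fun σ hσ => hcrit.unique hσ hacrit
  refine ⟨fun σ hσ => by simp [huniq σ hσ], a, ?_⟩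
  have key : ∀ i < W.k, {a} ∈ W.seq (i + 1) ∧ CollapsesOnto (W.seq (i + 1)) {{a}} := by
    intro i
    induction i with
    | zero => exact fun _ => by simp [ha, CollapsesOnto, Relation.ReflTransGen.refl]
    | succ i ih =>
      intro hi
      obtain ⟨hmem, hcol⟩ := ih (by omega)
      rcases W.step (i + 1) hi with hexp | ⟨σ, hfacet, heq⟩
      · exact ⟨hexp.subset hmem, Relation.ReflTransGen.head hexp hcol⟩
      · have hσ : σ = {a} := huniq σ ⟨i + 1, hi, hfacet.1, heq⟩
        rw [heq, hσ] at hmem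
        exact absurd hmem (Finset.notMem_erase _ _)
  have hlast := (key (W.k - 1) (by omega)).2
  rwa [Nat.sub_add_cancel hk, W.last] at hlast
end

section
/- Let K be a simplicial complex that is collapsible. Then K admits a Morse sequence having exactly one critical face, and this critical face is a 0-simplex. -/
/- Basic notions: simplicial complexes, facets, free pairs, expansions,
   fillings, collapses, Morse sequences, discrete vector fields,
   gradient paths, Morse functions. -/

variable {α : Type*} [DecidableEq α]

/-- An elementary collapse of a complex is a complex. -/
theorem ElemCollapse.isComplex {α : Type*} [DecidableEq α] {K L : Finset (Finset α)}
    (h : ElemCollapse K L) (hK : IsComplex K) : IsComplex L := by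
  obtain ⟨σ, τ, ⟨-, -, hστ, hfree⟩, rfl⟩ := h
  refine ⟨fun h => hK.1 (Finset.mem_sdiff.1 h).1, fun μ hμ ν hν hνμ => ?_⟩
  simp only [Finset.mem_sdiff, Finset.mem_insert, Finset.mem_singleton, not_or] at hμ ⊢
  obtain ⟨hμK, hμσ, hμτ⟩ := hμ
  refine ⟨hK.2 μ hμK ν hν hνμ, ?_, ?_⟩
  · rintro rfl
    exact hμτ (hfree μ hμK (lt_of_le_of_ne hνμ (Ne.symm hμσ)))
  · rintro rfl
    exact hμτ (hfree μ hμK (lt_of_lt_of_le hστ hνμ))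

/-- Removing a free pair never amounts to removing a single face. -/
theorem FreePair.sdiff_ne_erase {α : Type*} [DecidableEq α] {K : Finset (Finset α)}
    {σ τ : Finset α} (h : FreePair K σ τ) (ν : Finset α) : K \ {σ, τ} ≠ K.erase ν := by
  intro heq
  have hσ : σ = ν := by
    by_contra hne
    have := heq.symm.subset (Finset.mem_erase.2 ⟨hne, h.1⟩)
    simp at this
  have hτ : τ = ν := by
    by_contra hne
    have := heq.symm.subset (Finset.mem_erase.2 ⟨hne, h.2.1⟩)
    simp at this
  exact h.2.2.1.ne (hσ.trans hτ.symm)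

/-- The Morse sequence `⟨∅, {{a}}⟩` on a single vertex. -/
def MorseSequence.vertex {α : Type*} [DecidableEq α] (a : α) :
    MorseSequence {({a} : Finset α)} where
  k := 1
  seq i := if i = 0 then ∅ else {{a}}
  cplx i _ := by
    split_ifs
    · simp [IsComplex]
    · refine ⟨by simp, fun τ hτ σ hσ hστ => ?_⟩
      rw [Finset.mem_singleton] at hτ ⊢
      exact (hσ.subset_singleton_iff).1 (hτ ▸ hστ)
  first := rfl
  last := rfl
  step i hi := by
    obtain rfl : i = 0 := by omega
    exact Or.inr ⟨{a}, by simp [Facet], by simp⟩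

theorem MorseSequence.criticalFace_vertex_iff {α : Type*} [DecidableEq α] (a : α)
    (σ : Finset α) : CriticalFace (MorseSequence.vertex a) σ ↔ σ = {a} := by
  simp only [CriticalFace, MorseSequence.vertex, Nat.lt_one_iff, exists_eq_left]
  constructor
  · rintro ⟨h, -⟩
    simpa using h
  · rintro rfl
    simp

/-- Append an elementary expansion to a Morse sequence. -/
def MorseSequence.expand {α : Type*} [DecidableEq α] {K L : Finset (Finset α)}
    (W : MorseSequence L) (hK : IsComplex K) (h : ElemExpansion L K) : MorseSequence K where
  k := W.k + 1
  seq i := if i ≤ W.k then W.seq i else K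
  cplx i _ := by
    split_ifs with hi
    · exact W.cplx i hi
    · exact hK
  first := by simp [W.first]
  last := by simp
  step i hi := by
    rcases Nat.lt_succ_iff_lt_or_eq.1 hi with hi | rfl
    · simpa [hi.le, Nat.succ_le_of_lt hi] using W.step i hi
    · exact Or.inl (by simpa [W.last] using h)

/-- Appending an elementary expansion does not change the critical faces. -/
theorem MorseSequence.criticalFace_expand_iff {α : Type*} [DecidableEq α]
    {K L : Finset (Finset α)} (W : MorseSequence L) (hK : IsComplex K)
    (h : ElemExpansion L K) (ν : Finset α) :
    CriticalFace (W.expand hK h) ν ↔ CriticalFace W ν := by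
  constructor
  · rintro ⟨i, hi, hν, heq⟩
    rcases Nat.lt_succ_iff_lt_or_eq.1 hi with hi | rfl
    · exact ⟨i, hi, by simpa [expand, Nat.succ_le_of_lt hi] using hν,
        by simpa [expand, hi.le, Nat.succ_le_of_lt hi] using heq⟩
    · obtain ⟨σ, τ, hfree, hL⟩ := h
      refine absurd ?_ (hfree.sdiff_ne_erase ν)
      rw [← hL]
      simpa [expand, W.last] using heq
  · rintro ⟨i, hi, hν, heq⟩
    exact ⟨i, Nat.lt_succ_of_lt hi, by simpa [expand, Nat.succ_le_of_lt hi] using hν,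
      by simpa [expand, hi.le, Nat.succ_le_of_lt hi] using heq⟩

/-- A complex collapsing onto the vertex `a` has a Morse sequence whose only critical face
is `{a}`. -/
theorem CollapsesOnto.exists_morseSequence {α : Type*} [DecidableEq α]
    {K : Finset (Finset α)} {a : α} (h : CollapsesOnto K {({a} : Finset α)})
    (hK : IsComplex K) : ∃ W : MorseSequence K, ∀ σ, CriticalFace W σ ↔ σ = {a} := by
  induction h using Relation.ReflTransGen.head_induction_on with
  | refl => exact ⟨.vertex a, MorseSequence.criticalFace_vertex_iff a⟩
  | head hstep _ ih =>
    obtain ⟨W, hW⟩ := ih (hstep.isComplex hK)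
    exact ⟨W.expand hK hstep, fun σ => (W.criticalFace_expand_iff hK hstep σ).trans (hW σ)⟩

/-- A collapsible complex admits a Morse sequence with exactly one
critical face, which is a `0`-simplex. -/
theorem collapsible_admits_single_critical {α : Type*} [DecidableEq α]
    (K : Finset (Finset α)) (hK : IsComplex K) (hc : Collapsible K) :
    ∃ W : MorseSequence K, (∃! σ : Finset α, CriticalFace W σ) ∧
      ∀ σ : Finset α, CriticalFace W σ → σ.card = 1 := by
  obtain ⟨a, ha⟩ := hc
  obtain ⟨W, hW⟩ := CollapsesOnto.exists_morseSequence ha hK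
  refine ⟨W, ⟨{a}, (hW _).2 rfl, fun σ hσ => (hW σ).1 hσ⟩, fun σ hσ => ?_⟩
  rw [(hW σ).1 hσ, Finset.card_singleton]
end
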